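/- The abelian complexity function ρ of the ordinary paperfolding word satisfies ρ(n) ≤ ⌈log₂ n⌉ + 2 for all n ≥ 1, and equality ρ(n) = ⌈log₂ n⌉ + 2 holds for infinitely many n. -/

import Mathlib

/-- The ordinary paperfolding word over `{0,1}`, indexed from 1:
writing `n = n' * 2^k` with `n'` odd, `pf n = 0` if `n' ≡ 1 (mod 4)`
and `pf n = 1` if `n' ≡ 3 (mod 4)`.  (The value at `0` is irrelevant.) -/
def pf (n : ℕ) : ℕ := if (n / 2 ^ (n.factorization 2)) % 4 = 1 then 0 else 1

/-- The factor `f_i f_{i+1} ⋯ f_{i+n-1}` of the paperfolding word,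
of length `n`, starting at position `i`. -/
def pfFactor (i n : ℕ) : List ℕ := (List.range n).map (fun j => pf (i + j))

/-- `w` is a factor of the ordinary paperfolding word. -/
def IsPFFactor (w : List ℕ) : Prop := ∃ i : ℕ, 1 ≤ i ∧ w = pfFactor i w.length

/-- The abelian complexity function of the ordinary paperfolding word:
the number of abelian equivalence classes of factors of length `n`,
where the class of a factor `w` is determined by the pair
`(|w|_0, |w|_1)` of numbers of occurrences of `0` and `1` in `w`. -/
noncomputable def ρ (n : ℕ) : ℕ :=
  {p : ℕ × ℕ | ∃ i : ℕ, 1 ≤ i ∧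
    p = ((pfFactor i n).count 0, (pfFactor i n).count 1)}.ncard

/-- `Δ w = |w|_0 - |w|_1`. -/
def Δ (w : List ℕ) : ℤ := (w.count 0 : ℤ) - (w.count 1 : ℤ)

/-- `M n` is the maximum of `Δ w` over all factors `w` of the
paperfolding word of length `n`. -/
noncomputable def M (n : ℕ) : ℤ :=
  sSup {d : ℤ | ∃ i : ℕ, 1 ≤ i ∧ d = Δ (pfFactor i n)}

theorem pf_two_mul (m : ℕ) : pf (2 * m) = pf m := by
  rcases Nat.eq_zero_or_pos m with rfl | hm
  · rfl
  · have h : (2 * m).factorization 2 = m.factorization 2 + 1 := by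
      rw [Nat.factorization_mul (by norm_num) hm.ne']
      simp [Nat.prime_two.factorization, add_comm]
    unfold pf
    rw [h, pow_succ', Nat.mul_div_mul_left _ _ (by norm_num)]

theorem pf_two_mul_add_one (m : ℕ) : pf (2 * m + 1) = m % 2 := by
  have h : (2 * m + 1).factorization 2 = 0 :=
    Nat.factorization_eq_zero_of_not_dvd (by omega)
  unfold pf
  rw [h, pow_zero, Nat.div_one]
  split_ifs <;> omega

theorem pf_eq_zero_or_one (m : ℕ) : pf m = 0 ∨ pf m = 1 := by
  unfold pf
  split_ifs <;> simp

/-- Sum of the letters of `pfFactor a n` after the coding `0 ↦ 1`, `1 ↦ -1`. -/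
def pfSum (a n : ℕ) : ℤ := ∑ j ∈ Finset.range n, (1 - 2 * (pf (a + j) : ℤ))

theorem pfSum_succ (a n : ℕ) : pfSum a (n + 1) = pfSum a n + (1 - 2 * (pf (a + n) : ℤ)) :=
  Finset.sum_range_succ _ _

theorem pfSum_succ' (a n : ℕ) :
    pfSum a (n + 1) = (1 - 2 * (pf a : ℤ)) + pfSum (a + 1) n := by
  unfold pfSum
  rw [Finset.sum_range_succ', add_comm]
  simp only [add_zero, add_assoc, add_comm 1]

/-- Contribution of `n` consecutive odd positions, the first of which is `2 * a + 1`. -/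
def oddSum (a n : ℕ) : ℤ := if n % 2 = 0 then 0 else if a % 2 = 0 then 1 else -1

theorem pfSum_even_even (a n : ℕ) : pfSum (2 * a) (2 * n) = pfSum a n + oddSum a n := by
  induction n with
  | zero => simp [pfSum, oddSum]
  | succ n ih =>
    rw [show 2 * (n + 1) = 2 * n + 1 + 1 by ring, pfSum_succ, pfSum_succ, pfSum_succ, ih,
      show 2 * a + (2 * n + 1) = 2 * (a + n) + 1 by ring, ← mul_add, pf_two_mul,
      pf_two_mul_add_one]
    unfold oddSum
    split_ifs <;> push_cast <;> omega

theorem pfSum_even_odd (a n : ℕ) :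
    pfSum (2 * a) (2 * n + 1) = pfSum a (n + 1) + oddSum a n := by
  rw [pfSum_succ, pfSum_succ, pfSum_even_even, ← mul_add, pf_two_mul]
  ring

theorem pfSum_odd_even (a n : ℕ) :
    pfSum (2 * a + 1) (2 * n) = pfSum (a + 1) n + oddSum a n := by
  have h := pfSum_succ' (2 * a) (2 * n)
  rw [pfSum_even_odd, pfSum_succ', pf_two_mul] at h
  linarith

theorem pfSum_odd_odd (a n : ℕ) :
    pfSum (2 * a + 1) (2 * n + 1) = pfSum (a + 1) n + oddSum a (n + 1) := by
  have h := pfSum_succ' (2 * a) (2 * n + 1)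
  rw [show 2 * n + 1 + 1 = 2 * (n + 1) by ring, pfSum_even_even, pfSum_succ', pf_two_mul] at h
  linarith

theorem abs_oddSum_le_one (a n : ℕ) : |oddSum a n| ≤ 1 := by
  unfold oddSum
  split_ifs <;> simp

theorem abs_pfSum_le (n : ℕ) (hn : 1 ≤ n) (a : ℕ) : |pfSum a n| ≤ Nat.clog 2 n + 1 := by
  induction n using Nat.strong_induction_on generalizing a with
  | _ n ih =>
    rcases eq_or_lt_of_le hn with rfl | h2
    · rcases pf_eq_zero_or_one a with h | h <;> simp [pfSum, h]
    · have hc : Nat.clog 2 n = Nat.clog 2 ((n + 1) / 2) + 1 :=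
        Nat.clog_of_two_le (by norm_num) h2
      have key : ∀ b m c k : ℕ, pfSum a n = pfSum b m + oddSum c k → 1 ≤ m →
          m ≤ (n + 1) / 2 → |pfSum a n| ≤ Nat.clog 2 n + 1 := by
        intro b m c k h h1 hm
        have hS := ih m (by omega) h1 b
        have hO := abs_oddSum_le_one c k
        have hmono : Nat.clog 2 m ≤ Nat.clog 2 ((n + 1) / 2) := Nat.clog_mono_right 2 hm
        have htri := abs_add_le (pfSum b m) (oddSum c k)
        rw [h, hc]
        push_cast
        omega
      obtain ⟨b, rfl | rfl⟩ := Nat.even_or_odd' a <;>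
        obtain ⟨m, rfl | rfl⟩ := Nat.even_or_odd' n
      · exact key _ _ _ _ (pfSum_even_even b m) (by omega) (by omega)
      · exact key _ _ _ _ (pfSum_even_odd b m) (by omega) (by omega)
      · exact key _ _ _ _ (pfSum_odd_even b m) (by omega) (by omega)
      · exact key _ _ _ _ (pfSum_odd_odd b m) (by omega) (by omega)

/-- The extremal values `±(⌈log₂ n⌉ + 1)` are attained along a sequence of lengths
`n ∈ (2^k, 2^(k+1)]`, obtained by the rule `n ↦ 2n` for odd `n` and `n ↦ 2n - 1` for even `n`. -/
theorem exists_pfSum_extremal (k : ℕ) : ∃ n a b : ℕ, 2 ^ k < n ∧ n ≤ 2 ^ (k + 1) ∧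
    1 ≤ a ∧ 1 ≤ b ∧ a % 2 = 0 ∧ (n + b) % 2 = 1 ∧
    pfSum a n = k + 2 ∧ pfSum b n = -(k + 2) := by
  induction k with
  | zero =>
    refine ⟨2, 4, 11, by norm_num, by norm_num, by norm_num, by norm_num, by norm_num,
      by norm_num, ?_, ?_⟩
    · have h4 : pf 4 = 0 := by
        rw [pf_two_mul 2, pf_two_mul 1]; exact pf_two_mul_add_one 0
      have h5 : pf 5 = 0 := pf_two_mul_add_one 2
      simp [pfSum, Finset.sum_range_succ, h4, h5]
    · have h11 : pf 11 = 1 := pf_two_mul_add_one 5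
      have h12 : pf 12 = 1 := by
        rw [pf_two_mul 6, pf_two_mul 3]; exact pf_two_mul_add_one 1
      simp [pfSum, Finset.sum_range_succ, h11, h12]
  | succ k ih =>
    obtain ⟨n, a, b, hlo, hhi, ha, hb, ha2, hnb, hSa, hSb⟩ := ih
    have hp : 2 ^ (k + 1 + 1) = 2 * 2 ^ (k + 1) := pow_succ' 2 (k + 1)
    have hp' : 2 ^ (k + 1) = 2 * 2 ^ k := pow_succ' 2 k
    obtain ⟨m, rfl | rfl⟩ := Nat.even_or_odd' n
    · obtain ⟨l, rfl⟩ : ∃ l, m = l + 1 := ⟨m - 1, by omega⟩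
      refine ⟨2 * (2 * l + 1) + 1, 2 * a, 2 * b, by omega, by omega, by omega, by omega,
        by omega, by omega, ?_, ?_⟩
      · rw [pfSum_even_odd, show 2 * l + 1 + 1 = 2 * (l + 1) by ring, hSa]
        unfold oddSum
        split_ifs <;> omega
      · rw [pfSum_even_odd, show 2 * l + 1 + 1 = 2 * (l + 1) by ring, hSb]
        unfold oddSum
        split_ifs <;> omega
    · obtain ⟨c, rfl⟩ : ∃ c, b = c + 1 := ⟨b - 1, by omega⟩
      refine ⟨2 * (2 * m + 1), 2 * a, 2 * c + 1, by omega, by omega, by omega, by omega,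
        by omega, by omega, ?_, ?_⟩
      · rw [pfSum_even_even, hSa]
        unfold oddSum
        split_ifs <;> omega
      · rw [pfSum_odd_even, hSb]
        unfold oddSum
        split_ifs <;> omega

theorem count_pfFactor (i n : ℕ) :
    (pfFactor i n).count 0 + (pfFactor i n).count 1 = n ∧
      2 * ((pfFactor i n).count 0 : ℤ) = n + pfSum i n := by
  induction n with
  | zero => simp [pfFactor, pfSum]
  | succ n ih =>
    have h : pfFactor i (n + 1) = pfFactor i n ++ [pf (i + n)] := by
      simp [pfFactor, List.range_succ]
    rw [h, pfSum_succ, List.count_append, List.count_append]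
    rcases pf_eq_zero_or_one (i + n) with hp | hp <;> rw [hp] <;> simp <;> omega

theorem count_pfFactor_shift (i n : ℕ) :
    (pfFactor (i + 1) n).count 0 ≤ (pfFactor i n).count 0 + 1 ∧
      (pfFactor i n).count 0 ≤ (pfFactor (i + 1) n).count 0 + 1 := by
  have h0 := (count_pfFactor i n).2
  have h1 := (count_pfFactor (i + 1) n).2
  have h := pfSum_succ i n
  rw [pfSum_succ'] at h
  rcases pf_eq_zero_or_one i with hp | hp <;>
    rcases pf_eq_zero_or_one (i + n) with hq | hq <;>
    rw [hp, hq] at h <;> push_cast at h <;> omega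

/-- Discrete intermediate value theorem for sequences with steps of size at most one. -/
theorem exists_eq_of_step_le_one {g : ℕ → ℕ} (hg : ∀ i, g (i + 1) ≤ g i + 1 ∧ g i ≤ g (i + 1) + 1)
    {a b v : ℕ} (hab : a ≤ b) (hv : g a ≤ v ∧ v ≤ g b ∨ g b ≤ v ∧ v ≤ g a) :
    ∃ i, a ≤ i ∧ g i = v := by
  induction b, hab using Nat.le_induction with
  | base => exact ⟨a, le_rfl, by omega⟩
  | succ b hab ih =>
    by_cases h : g (b + 1) = v
    · exact ⟨b + 1, by omega, h⟩
    · have := hg b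
      exact ih (by omega)

theorem rho_le {n B : ℕ} (h : ∀ i, |pfSum i n| ≤ B) : ρ n ≤ B + 1 := by
  have hsub : {p : ℕ × ℕ | ∃ i : ℕ, 1 ≤ i ∧
      p = ((pfFactor i n).count 0, (pfFactor i n).count 1)} ⊆
      (((Finset.Icc ((n - B + 1) / 2) ((n + B) / 2)).image fun c => (c, n - c) :
        Finset (ℕ × ℕ)) : Set (ℕ × ℕ)) := by
    rintro p ⟨i, -, rfl⟩
    obtain ⟨h1, h2⟩ := count_pfFactor i n
    have h3 := abs_le.mp (h i)
    rw [Finset.mem_coe, Finset.mem_image]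
    refine ⟨(pfFactor i n).count 0, Finset.mem_Icc.mpr ⟨by omega, by omega⟩, ?_⟩
    rw [Prod.mk.injEq]
    exact ⟨rfl, by omega⟩
  refine (Set.ncard_le_ncard hsub (Finset.finite_toSet _)).trans ?_
  rw [Set.ncard_coe_finset]
  refine Finset.card_image_le.trans ?_
  rw [Nat.card_Icc]
  omega

theorem le_rho {n B a b : ℕ} (ha : 1 ≤ a) (hb : 1 ≤ b) (hSa : pfSum a n = B)
    (hSb : pfSum b n = -B) : B + 1 ≤ ρ n := by
  obtain ⟨a1, a2⟩ := count_pfFactor a n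
  obtain ⟨b1, b2⟩ := count_pfFactor b n
  have hsub : (((Finset.Icc ((pfFactor b n).count 0) ((pfFactor a n).count 0)).image
      fun c => (c, n - c) : Finset (ℕ × ℕ)) : Set (ℕ × ℕ)) ⊆
      {p : ℕ × ℕ | ∃ i : ℕ, 1 ≤ i ∧
        p = ((pfFactor i n).count 0, (pfFactor i n).count 1)} := by
    intro p hp
    rw [Finset.mem_coe, Finset.mem_image] at hp
    obtain ⟨c, hc, rfl⟩ := hp
    rw [Finset.mem_Icc] at hc
    have hex : ∃ i, 1 ≤ i ∧ (pfFactor i n).count 0 = c := by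
      have hg := fun i => count_pfFactor_shift i n
      rcases le_total a b with hab | hab
      · obtain ⟨i, hi, h⟩ := exists_eq_of_step_le_one
          (g := fun i => (pfFactor i n).count 0) hg hab (Or.inr hc)
        exact ⟨i, ha.trans hi, h⟩
      · obtain ⟨i, hi, h⟩ := exists_eq_of_step_le_one
          (g := fun i => (pfFactor i n).count 0) hg hab (Or.inl hc)
        exact ⟨i, hb.trans hi, h⟩
    obtain ⟨i, hi, rfl⟩ := hex
    refine ⟨i, hi, ?_⟩
    have := (count_pfFactor i n).1
    rw [Prod.mk.injEq]
    exact ⟨rfl, by omega⟩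
  have hfin : {p : ℕ × ℕ | ∃ i : ℕ, 1 ≤ i ∧
      p = ((pfFactor i n).count 0, (pfFactor i n).count 1)}.Finite := by
    refine (Finset.finite_toSet (Finset.range (n + 1) ×ˢ Finset.range (n + 1))).subset ?_
    rintro p ⟨i, -, rfl⟩
    have := (count_pfFactor i n).1
    rw [Finset.mem_coe, Finset.mem_product, Finset.mem_range, Finset.mem_range]
    exact ⟨by dsimp only; omega, by dsimp only; omega⟩
  refine le_trans ?_ (Set.ncard_le_ncard hsub hfin)
  rw [Set.ncard_coe_finset, Finset.card_image_of_injective _ fun x y h => (Prod.mk.inj h).1,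
    Nat.card_Icc]
  omega

/-- `ρ(n) ≤ ⌈log₂ n⌉ + 2` for all `n ≥ 1`, with equality for infinitely many `n`.
Here `⌈log₂ n⌉` is the least `k` with `n ≤ 2^k`, i.e. `Nat.clog 2 n`. -/
theorem pf_rho_le_clog :
    (∀ n : ℕ, 1 ≤ n → ρ n ≤ Nat.clog 2 n + 2) ∧
    (∀ N : ℕ, ∃ n : ℕ, N ≤ n ∧ 1 ≤ n ∧ ρ n = Nat.clog 2 n + 2) := by
  have upper : ∀ n : ℕ, 1 ≤ n → ρ n ≤ Nat.clog 2 n + 2 := fun n hn =>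
    rho_le fun i => by exact_mod_cast abs_pfSum_le n hn i
  refine ⟨upper, fun N => ?_⟩
  obtain ⟨n, a, b, hlo, hhi, ha, hb, -, -, hSa, hSb⟩ := exists_pfSum_extremal N
  have hN : N < 2 ^ N := Nat.lt_two_pow_self
  refine ⟨n, by omega, by omega, le_antisymm (upper n (by omega)) ?_⟩
  have hc : Nat.clog 2 n ≤ N + 1 := Nat.clog_le_of_le_pow hhi
  have hle : N + 2 + 1 ≤ ρ n :=
    le_rho ha hb (by rw [hSa]; push_cast; ring) (by rw [hSb]; push_cast; ring)
  omega
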